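/- Let T be a tree with no regular cores and exactly two cores u and v, both small (so each of u and v has two standard legs, and the subtree of its remaining neighbor, which contains the other small core, is its modified leg). A set L ⊆ V is a landmark set of T if and only if L contains a local set for the three g-legs of v and contains a local set for the three g-legs of u. -/

import Mathlib

open SimpleGraph

variable {V : Type*} [Fintype V] [DecidableEq V]

/-- A vertex `τ` separates `u` and `w` if its distances to them differ. -/
def Separates (T : SimpleGraph V) (τ u w : V) : Prop :=
  T.dist τ u ≠ T.dist τ w

/-- There are at least two vertices of `L` separating `u` and `w`. -/
def HasTwoSeparators (T : SimpleGraph V) (L : Set V) (u w : V) : Prop :=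
  ∃ τ₁ ∈ L, ∃ τ₂ ∈ L, τ₁ ≠ τ₂ ∧ Separates T τ₁ u w ∧ Separates T τ₂ u w

/-- `L` is a landmark set (non-landmarks model, `k = 2`): every pair of distinct
vertices outside `L` is separated by at least two vertices of `L`. -/
def IsLandmarkSet (T : SimpleGraph V) (L : Set V) : Prop :=
  ∀ u w : V, u ≠ w → u ∉ L → w ∉ L → HasTwoSeparators T L u w

/-- A core is a vertex of degree at least 3. -/
def IsCore (T : SimpleGraph V) [DecidableRel T.Adj] (v : V) : Prop :=
  3 ≤ T.degree v

/-- The subtree of the neighbor `x` of `v`: in a tree, the connected component of `x`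
obtained by removing `v`, characterized via distances (`w` is in it iff the path from
`v` to `w` passes through `x`). -/
def Branch (T : SimpleGraph V) (v x : V) : Set V :=
  {w | T.dist v w = T.dist x w + 1}

/-- The subtree of the neighbor `x` of `v` is a (standard) leg:
a path containing no cores. -/
def IsStandardLeg (T : SimpleGraph V) [DecidableRel T.Adj] (v x : V) : Prop :=
  T.Adj v x ∧ ∀ w ∈ Branch T v x, T.degree w ≤ 2

/-- A short leg consists of a single vertex. -/
def IsShortLeg (T : SimpleGraph V) [DecidableRel T.Adj] (v x : V) : Prop :=
  IsStandardLeg T v x ∧ Branch T v x = {x}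

/-- A long leg is a standard leg that is not short. -/
def IsLongLeg (T : SimpleGraph V) [DecidableRel T.Adj] (v x : V) : Prop :=
  IsStandardLeg T v x ∧ Branch T v x ≠ {x}

/-- A small core: degree exactly 3, with at least two standard legs, one of which is short. -/
def IsSmallCore (T : SimpleGraph V) [DecidableRel T.Adj] (v : V) : Prop :=
  T.degree v = 3 ∧ ∃ x y : V, x ≠ y ∧ IsShortLeg T v x ∧ IsStandardLeg T v y

/-- A regular core is a core that is not small. -/
def IsRegularCore (T : SimpleGraph V) [DecidableRel T.Adj] (v : V) : Prop :=
  IsCore T v ∧ ¬ IsSmallCore T v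

/-- A modified leg of `v`: a subtree of a neighbor of `v` containing exactly one core,
which is a small core. -/
def IsModifiedLeg (T : SimpleGraph V) [DecidableRel T.Adj] (v x : V) : Prop :=
  T.Adj v x ∧ ∃ u ∈ Branch T v x, IsSmallCore T u ∧
    ∀ w ∈ Branch T v x, IsCore T w → w = u

/-- A g-leg is a standard leg or a modified leg. -/
def IsGLeg (T : SimpleGraph V) [DecidableRel T.Adj] (v x : V) : Prop :=
  IsStandardLeg T v x ∨ IsModifiedLeg T v x

/-- A minor core: a regular core which either (i) has at most one g-leg, or
(ii) has degree at least 4, no modified legs, exactly two standard legs one of which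
is short, and every other subtree of a neighbor contains a regular core. -/
def IsMinorCore (T : SimpleGraph V) [DecidableRel T.Adj] (v : V) : Prop :=
  IsRegularCore T v ∧
  ((∀ x y : V, IsGLeg T v x → IsGLeg T v y → x = y) ∨
   (4 ≤ T.degree v ∧ (∀ x : V, ¬ IsModifiedLeg T v x) ∧
    (∃ x y : V, x ≠ y ∧ IsShortLeg T v x ∧ IsStandardLeg T v y ∧
      ∀ z : V, IsStandardLeg T v z → z = x ∨ z = y) ∧
    (∀ z : V, T.Adj v z → ¬ IsGLeg T v z → ∃ w ∈ Branch T v z, IsRegularCore T w)))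

/-- A main core is a regular core that is not minor. -/
def IsMainCore (T : SimpleGraph V) [DecidableRel T.Adj] (v : V) : Prop :=
  IsRegularCore T v ∧ ¬ IsMinorCore T v

/-- The vertices lying on g-legs of `v`. -/
def GLegVerts (T : SimpleGraph V) [DecidableRel T.Adj] (v : V) : Set V :=
  {w | ∃ x : V, IsGLeg T v x ∧ w ∈ Branch T v x}

/-- Type (s,0) solution on the leg of neighbor `x` of `v`: the empty set. -/
def SolS0 (T : SimpleGraph V) (v x : V) (S : Set V) : Prop :=
  S ∩ Branch T v x = ∅

/-- Type (s,1) solution: one vertex of the leg whose position is at least 2. -/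
def SolS1 (T : SimpleGraph V) (v x : V) (S : Set V) : Prop :=
  ∃ w : V, S ∩ Branch T v x = {w} ∧ 2 ≤ T.dist v w

/-- Type (s,2) solution: at least two vertices of the leg. -/
def SolS2 (T : SimpleGraph V) (v x : V) (S : Set V) : Prop :=
  ∃ w₁ ∈ S ∩ Branch T v x, ∃ w₂ ∈ S ∩ Branch T v x, w₁ ≠ w₂

/-- Type (s,3) solution: exactly the vertex with position 1 (that is, `x`). -/
def SolS3 (T : SimpleGraph V) (v x : V) (S : Set V) : Prop :=
  S ∩ Branch T v x = {x}

/-- For a modified leg `x` of `v`: `u` is its small core (at position `T.dist v u`),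
and `a`, `b` are the two vertices at position `T.dist v u + 1`, where `b` is the
vertex of a short leg of `u` (the vertex `ℓ^b`) and `a` is the other one (`ℓ^a`). -/
def MLegPair (T : SimpleGraph V) [DecidableRel T.Adj] (v x u a b : V) : Prop :=
  u ∈ Branch T v x ∧ IsSmallCore T u ∧ a ≠ b ∧
  a ∈ Branch T v x ∧ b ∈ Branch T v x ∧
  T.dist v a = T.dist v u + 1 ∧ T.dist v b = T.dist v u + 1 ∧
  IsShortLeg T u b

/-- Type (m,1) solution on the modified leg `x` of `v`: either `{ℓ^a}` or `{ℓ^b}`. -/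
def SolM1 (T : SimpleGraph V) [DecidableRel T.Adj] (v x : V) (S : Set V) : Prop :=
  ∃ u a b : V, MLegPair T v x u a b ∧
    (S ∩ Branch T v x = {a} ∨ S ∩ Branch T v x = {b})

/-- Type (m,2) solution: contains neither `ℓ^a` nor `ℓ^b`, contains at least two
vertices of positions at least `i + 2`, and no vertex of position `i + 1`. -/
def SolM2 (T : SimpleGraph V) [DecidableRel T.Adj] (v x : V) (S : Set V) : Prop :=
  ∃ u a b : V, MLegPair T v x u a b ∧ a ∉ S ∧ b ∉ S ∧
    (∃ w₁ ∈ S ∩ Branch T v x, ∃ w₂ ∈ S ∩ Branch T v x, w₁ ≠ w₂ ∧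
      T.dist v u + 2 ≤ T.dist v w₁ ∧ T.dist v u + 2 ≤ T.dist v w₂) ∧
    ∀ w ∈ S ∩ Branch T v x, T.dist v w ≠ T.dist v u + 1

/-- Type (m,3) solution: at least two vertices, one of which is `ℓ^a` or `ℓ^b`. -/
def SolM3 (T : SimpleGraph V) [DecidableRel T.Adj] (v x : V) (S : Set V) : Prop :=
  ∃ u a b : V, MLegPair T v x u a b ∧
    (∃ w₁ ∈ S ∩ Branch T v x, ∃ w₂ ∈ S ∩ Branch T v x, w₁ ≠ w₂) ∧
    (a ∈ S ∨ b ∈ S)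

/-- `S` is a local set for the core `v`. -/
def IsLocalSet (T : SimpleGraph V) [DecidableRel T.Adj] (v : V) (S : Set V) : Prop :=
  S ⊆ GLegVerts T v ∧
  -- (1) at most one standard leg has a type (s,0) solution, and every standard leg
  -- has a solution of one of the types (s,0), (s,1), (s,2), (s,3)
  (∀ x y : V, IsStandardLeg T v x → IsStandardLeg T v y → x ≠ y →
    SolS0 T v x S → SolS0 T v y S → False) ∧
  (∀ x : V, IsStandardLeg T v x →
    SolS0 T v x S ∨ SolS1 T v x S ∨ SolS2 T v x S ∨ SolS3 T v x S) ∧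
  -- (2) every modified leg has a solution of type (m,1), (m,2) or (m,3)
  (∀ x : V, IsModifiedLeg T v x →
    SolM1 T v x S ∨ SolM2 T v x S ∨ SolM3 T v x S) ∧
  -- (3) if some standard leg has a type (s,0) solution, no modified leg has type (m,1)
  ((∃ x : V, IsStandardLeg T v x ∧ SolS0 T v x S) →
    ∀ y : V, IsModifiedLeg T v y → ¬ SolM1 T v y S) ∧
  -- (4) if some long leg has a type (s,0) solution, every other long leg has type (s,2)
  (∀ x : V, IsLongLeg T v x → SolS0 T v x S →
    ∀ y : V, IsLongLeg T v y → y ≠ x → SolS2 T v y S) ∧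
  -- (5) if some short leg has a type (s,0) solution, every long leg has type (s,2) or (s,3)
  ((∃ x : V, IsShortLeg T v x ∧ SolS0 T v x S) →
    ∀ y : V, IsLongLeg T v y → SolS2 T v y S ∨ SolS3 T v y S)

/-- A local set is thrifty if its solutions of types (s,2), (m,2) and (m,3)
consist of exactly two vertices each. -/
def IsThrifty (T : SimpleGraph V) [DecidableRel T.Adj] (v : V) (S : Set V) : Prop :=
  (∀ x : V, IsStandardLeg T v x → SolS2 T v x S → (S ∩ Branch T v x).ncard = 2) ∧
  (∀ x : V, IsModifiedLeg T v x → (SolM2 T v x S ∨ SolM3 T v x S) →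
    (S ∩ Branch T v x).ncard = 2)

theorem mem_branch {V : Type*} {T : SimpleGraph V} {v x w : V} :
    w ∈ Branch T v x ↔ T.dist v w = T.dist x w + 1 :=
  Iff.rfl

theorem branch_unique {V : Type*} {T : SimpleGraph V} (hT : T.IsTree) {v x y w : V}
    (hx : T.Adj v x) (hy : T.Adj v y) (hwx : w ∈ Branch T v x) (hwy : w ∈ Branch T v y) :
    x = y := by
  obtain ⟨p, hp⟩ := hT.connected.exists_walk_length_eq_dist x w
  obtain ⟨q, hq⟩ := hT.connected.exists_walk_length_eq_dist y w
  simp only [mem_branch] at hwx hwy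
  have hp' : (Walk.cons hx p).IsPath :=
    Walk.isPath_of_length_eq_dist _ (by rw [Walk.length_cons]; omega)
  have hq' : (Walk.cons hy q).IsPath :=
    Walk.isPath_of_length_eq_dist _ (by rw [Walk.length_cons]; omega)
  have h := congrArg (fun r : T.Path v w => r.1.snd)
    ((hT.isAcyclic.subsingleton_path v w).elim ⟨_, hp'⟩ ⟨_, hq'⟩)
  simpa using h

theorem exists_mem_branch {V : Type*} {T : SimpleGraph V} (hT : T.IsTree) {v w : V}
    (h : w ≠ v) : ∃ x, T.Adj v x ∧ w ∈ Branch T v x := by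
  obtain ⟨p, hp⟩ := hT.connected.exists_walk_length_eq_dist v w
  cases p with
  | nil => exact absurd rfl h
  | cons hx q =>
    rename_i x
    refine ⟨x, hx, ?_⟩
    rw [Walk.length_cons] at hp
    have h1 := T.dist_le q
    have h2 := hT.dist_eq_dist_add_one_of_adj w hx
    simp only [mem_branch]
    rw [T.dist_comm (u := w), T.dist_comm (u := w)] at h2
    omega

theorem not_mem_branch_iff {V : Type*} {T : SimpleGraph V} (hT : T.IsTree) {v x w : V}
    (h : T.Adj v x) : w ∉ Branch T v x ↔ T.dist x w = T.dist v w + 1 := by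
  have h2 := hT.dist_eq_dist_add_one_of_adj w h
  rw [T.dist_comm (u := w), T.dist_comm (u := w)] at h2
  simp only [mem_branch]
  omega

theorem not_mem_branch_self {V : Type*} {T : SimpleGraph V} {v x : V} : v ∉ Branch T v x := by
  simp [mem_branch]

theorem mem_branch_of_adj {V : Type*} {T : SimpleGraph V} {v x : V} (h : T.Adj v x) :
    x ∈ Branch T v x := by
  simp [mem_branch, dist_eq_one_iff_adj.mpr h]

theorem dist_eq_add_of_mem_branch {V : Type*} {T : SimpleGraph V} (hT : T.IsTree) {w w' : V} :
    ∀ (n : ℕ) (s t : V), T.dist t w' = n → T.Adj s t → w ∉ Branch T s t → w' ∈ Branch T s t →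
      T.dist w w' = T.dist w s + T.dist s w' := by
  intro n
  induction n with
  | zero =>
    intro s t h0 hst hw hw'
    obtain rfl := hT.connected.dist_eq_zero_iff.mp h0
    rw [not_mem_branch_iff hT hst, T.dist_comm, T.dist_comm (u := s)] at hw
    rw [hw, dist_eq_one_iff_adj.mpr hst]
  | succ n ih =>
    intro s t hn hst hw hw'
    have hne : w' ≠ t := by rintro rfl; simp at hn
    obtain ⟨r, htr, hr⟩ := exists_mem_branch hT hne
    have hws : w ∈ Branch T t s := (not_mem_branch_iff hT hst).mp hw
    have hrs : r ≠ s := by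
      rintro rfl
      simp only [mem_branch] at hr hw'
      omega
    have hwr : w ∉ Branch T t r := fun h => hrs (branch_unique hT htr hst.symm h hws)
    have := ih t r (by simp only [mem_branch] at hr; omega) htr hwr hr
    have h1 := (not_mem_branch_iff hT hst).mp hw
    simp only [mem_branch] at hw'
    rw [T.dist_comm (u := t), T.dist_comm (u := s)] at h1
    omega

theorem dist_eq_add_of_branch_ne {V : Type*} {T : SimpleGraph V} (hT : T.IsTree)
    {v x y w w' : V} (hx : T.Adj v x) (hy : T.Adj v y) (hxy : x ≠ y)
    (hw : w ∈ Branch T v x) (hw' : w' ∈ Branch T v y) :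
    T.dist w w' = T.dist v w + T.dist v w' := by
  rw [T.dist_comm (u := v) (v := w)]
  exact dist_eq_add_of_mem_branch hT _ v y rfl hy
    (fun h => hxy (branch_unique hT hx hy hw h)) hw'

theorem branch_subset {V : Type*} {T : SimpleGraph V} (hT : T.IsTree)
    {v x y : V} (hx : T.Adj v x) (hy : T.Adj x y) (hne : y ≠ v) :
    Branch T x y ⊆ Branch T v x := by
  intro w hw
  by_contra h
  exact hne (branch_unique hT hy hx.symm hw ((not_mem_branch_iff hT hx).mp h))

/-- If, away from a pendant vertex `b`, the branch of `x` at `v` never forks, then distances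
inside it are differences of distances from `v`. -/
theorem dist_eq_abs_of_no_fork {V : Type*} {T : SimpleGraph V} (hT : T.IsTree) {b : V}
    (hb : ∀ z, T.Adj z b → Branch T z b = {b}) :
    ∀ (n : ℕ) (v x w w' : V), T.dist x w = n → T.Adj v x →
      (∀ z ∈ Branch T v x, ∀ y y', T.Adj z y → T.Adj z y' → y ∈ Branch T v x →
        y' ∈ Branch T v x → T.dist v y = T.dist v z + 1 → T.dist v y' = T.dist v z + 1 →
        y ≠ b → y' ≠ b → y = y') →
      w ∈ Branch T v x → w' ∈ Branch T v x → w ≠ b → w' ≠ b → T.dist v w ≤ T.dist v w' →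
      (T.dist w w' : ℤ) = T.dist v w' - T.dist v w := by
  intro n
  induction n with
  | zero =>
    intro v x w w' h0 hvx H hw hw' hwb hwb' hle
    obtain rfl := hT.connected.dist_eq_zero_iff.mp h0
    have h1 := dist_eq_one_iff_adj.mpr hvx
    simp only [mem_branch] at hw'
    omega
  | succ n ih =>
    intro v x w w' hn hvx H hw hw' hwb hwb' hle
    have hw1 : T.dist v w = T.dist x w + 1 := hw
    have hw2 : T.dist v w' = T.dist x w' + 1 := hw'
    have key : ∀ z, z ∈ Branch T v x → z ≠ b → T.dist x z ≠ 0 →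
        ∃ y, T.Adj x y ∧ z ∈ Branch T x y ∧ y ≠ v ∧ y ≠ b := by
      intro z hz hzb hz0
      obtain ⟨y, hxy, hy⟩ := exists_mem_branch hT (v := x) (w := z)
        (by rintro rfl; simp at hz0)
      refine ⟨y, hxy, hy, ?_, ?_⟩
      · rintro rfl
        simp only [mem_branch] at hy hz
        omega
      · rintro rfl
        rw [hb x hxy] at hy
        exact hzb hy
    obtain ⟨y, hxy, hy, hyv, hyb⟩ := key w hw hwb (by omega)
    obtain ⟨y', hxy', hy', hyv', hyb'⟩ := key w' hw' hwb' (by omega)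
    have up : ∀ c, T.Adj x c → c ≠ v → c ∈ Branch T v x ∧ T.dist v c = T.dist v x + 1 := by
      intro c hc hcv
      have h1 := branch_subset hT hvx hc hcv (mem_branch_of_adj hc)
      refine ⟨h1, ?_⟩
      simp only [mem_branch] at h1
      rw [h1, dist_eq_one_iff_adj.mpr hc, dist_eq_one_iff_adj.mpr hvx]
    have hyy : y = y' := H x (mem_branch_of_adj hvx) y y' hxy hxy' (up y hxy hyv).1
      (up y' hxy' hyv').1 (up y hxy hyv).2 (up y' hxy' hyv').2 hyb hyb'
    subst hyy
    have hsub := branch_subset hT hvx hxy hyv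
    have := ih x y w w' (by simp only [mem_branch] at hy; omega) hxy
      (fun z hz c c' hc hc' hcb hcb' hd hd' hne hne' =>
        H z (hsub hz) c c' hc hc' (hsub hcb) (hsub hcb')
          (by have h1 : _ = _ := hsub hcb; have h2 : _ = _ := hsub hz; omega)
          (by have h1 : _ = _ := hsub hcb'; have h2 : _ = _ := hsub hz; omega) hne hne')
      hy hy' hwb hwb' (by omega)
    omega

theorem exists_third_neighbor {V : Type*} [Fintype V] [DecidableEq V] {T : SimpleGraph V}
    [DecidableRel T.Adj] {v a b : V} (hv : T.degree v = 3) (ha : T.Adj v a) (hb : T.Adj v b)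
    (hab : a ≠ b) :
    ∃ c, c ≠ a ∧ c ≠ b ∧ T.Adj v c ∧ ∀ y, T.Adj v y → y = a ∨ y = b ∨ y = c := by
  have hcard : (((T.neighborFinset v).erase a).erase b).card = 1 := by
    rw [Finset.card_erase_of_mem, Finset.card_erase_of_mem, card_neighborFinset_eq_degree, hv]
    · simpa using ha
    · simpa [hab.symm] using hb
  obtain ⟨c, hc⟩ := Finset.card_eq_one.mp hcard
  have hmem : ∀ y, y ∈ ((T.neighborFinset v).erase a).erase b ↔ y = c := by simp [hc]
  simp only [Finset.mem_erase, mem_neighborFinset] at hmem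
  have := (hmem c).mpr rfl
  refine ⟨c, this.2.1, this.1, this.2.2, fun y hy => ?_⟩
  by_cases h1 : y = a
  · exact Or.inl h1
  by_cases h2 : y = b
  · exact Or.inr (Or.inl h2)
  · exact Or.inr (Or.inr ((hmem y).mp ⟨h2, h1, hy⟩))

theorem eq_of_degree_le_two {V : Type*} [Fintype V] {T : SimpleGraph V}
    [DecidableRel T.Adj] (hT : T.IsTree) {v z y y' : V} (hz : T.degree z ≤ 2) (hzv : z ≠ v)
    (hy : T.Adj z y) (hy' : T.Adj z y') (h : T.dist v y = T.dist v z + 1)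
    (h' : T.dist v y' = T.dist v z + 1) : y = y' := by
  classical
  by_contra hne
  obtain ⟨q, hq, hvq⟩ := exists_mem_branch hT hzv.symm
  simp only [mem_branch] at hvq
  rw [T.dist_comm, T.dist_comm (u := q)] at hvq
  have hqy : q ≠ y := by rintro rfl; omega
  have hqy' : q ≠ y' := by rintro rfl; omega
  have hsub : ({q, y, y'} : Finset V) ⊆ T.neighborFinset z := by
    intro c hc
    simp only [Finset.mem_insert, Finset.mem_singleton] at hc
    rcases hc with rfl | rfl | rfl <;> simpa
  have := Finset.card_le_card hsub
  rw [Finset.card_eq_three.mpr ⟨q, y, y', hqy, hqy', hne, rfl⟩,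
    card_neighborFinset_eq_degree] at this
  omega

theorem exists_small_core_neighbors {V : Type*} [Fintype V] [DecidableEq V] {T : SimpleGraph V}
    [DecidableRel T.Adj] (hT : T.IsTree) {u v : V} (huv : u ≠ v) (hu : IsSmallCore T u)
    (hv : IsSmallCore T v) :
    ∃ a b x : V, a ≠ b ∧ x ≠ a ∧ x ≠ b ∧ IsStandardLeg T v a ∧ IsShortLeg T v b ∧ T.Adj v x ∧
      (∀ y, T.Adj v y → y = a ∨ y = b ∨ y = x) ∧ u ∈ Branch T v x := by
  obtain ⟨hd, b, a, hba, hb, ha⟩ := hv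
  obtain ⟨x, hxa, hxb, hx, hall⟩ := exists_third_neighbor hd ha.1 hb.1.1 hba.symm
  refine ⟨a, b, x, hba.symm, hxa, hxb, ha, hb, hx, hall, ?_⟩
  obtain ⟨y, hy, huy⟩ := exists_mem_branch hT huv
  have hud := hu.1
  rcases hall y hy with rfl | rfl | rfl
  · have := ha.2 u huy
    omega
  · have := hb.1.2 u huy
    omega
  · exact huy

theorem short_leg_unique_neighbor {V : Type*} {T : SimpleGraph V} (hT : T.IsTree) {v b : V}
    (hvb : T.Adj v b) (h : Branch T v b = {b}) {z : V} (hz : T.Adj z b) : z = v := by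
  by_contra hne
  have := branch_subset hT hvb hz.symm hne (mem_branch_of_adj hz.symm)
  rw [h] at this
  exact hz.ne this

/-- Coordinates on a tree with exactly two cores `v` and `u`, both small. Apart from the pendant
vertices `bv` and `bu`, the vertices lie on a line along which `f` measures position, with `v` at
`0` and `u` at `p`; `f` gives a pendant vertex the position of its neighbor. -/
structure IsFrame {V : Type*} (T : SimpleGraph V) (f : V → ℤ) (p : ℤ)
    (v av bv xv u au bu xu : V) : Prop where
  one_le : 1 ≤ p
  f_v : f v = 0
  f_av : f av = -1
  f_bv : f bv = 0
  f_xv : f xv = 1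
  f_u : f u = p
  f_au : f au = p + 1
  f_bu : f bu = p
  f_xu : f xu = p - 1
  v_ne : v ≠ bv
  xv_ne : xv ≠ bu
  u_ne : u ≠ bu
  xu_ne : xu ≠ bv
  dist_line : ∀ x y, x ≠ bv → x ≠ bu → y ≠ bv → y ≠ bu → (T.dist x y : ℤ) = |f x - f y|
  dist_bv : ∀ x, x ≠ bv → x ≠ bu → (T.dist bv x : ℤ) = |f x| + 1
  dist_bu : ∀ x, x ≠ bv → x ≠ bu → (T.dist bu x : ℤ) = |f x - p| + 1
  dist_bv_bu : (T.dist bv bu : ℤ) = p + 2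

theorem exists_isFrame {V : Type*} [Fintype V] [DecidableEq V] {T : SimpleGraph V}
    [DecidableRel T.Adj] (hT : T.IsTree) {u v : V} (huv : u ≠ v) (hu : IsSmallCore T u)
    (hv : IsSmallCore T v) (huniq : ∀ w : V, IsCore T w → w = u ∨ w = v) :
    ∃ f p av bv xv au bu xu, IsFrame T f p v av bv xv u au bu xu := by
  obtain ⟨av, bv, xv, habv, hxav, hxbv, hav, hbv, hxv, hallv, huv'⟩ :=
    exists_small_core_neighbors hT huv hu hv
  obtain ⟨au, bu, xu, habu, hxau, hxbu, hau, hbu, hxu, hallu, hvu'⟩ :=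
    exists_small_core_neighbors hT huv.symm hv hu
  have hdegu := hu.1
  have hdegv := hv.1
  have hdeg : ∀ w, w ≠ u → w ≠ v → T.degree w ≤ 2 := by
    intro w h1 h2
    by_contra h
    rcases huniq w (by unfold IsCore; omega) with h' | h'
    exacts [h1 h', h2 h']
  set p := T.dist v u with hp
  have hp1 : 1 ≤ p := hT.connected.pos_dist_of_ne huv.symm
  have beyond : ∀ c, T.Adj u c → c ≠ xu → T.dist v c = p + 1 := by
    intro c hc hcx
    have h := (not_mem_branch_iff hT hc).mp
      (fun h => hcx (branch_unique hT hc hxu h hvu'))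
    rw [T.dist_comm, h, T.dist_comm (u := u)]
  have beyond_mem : ∀ c, T.Adj u c → c ≠ xu → c ∈ Branch T v xv := by
    intro c hc hcx
    obtain ⟨y, hy, hcy⟩ := exists_mem_branch hT (v := v) (w := c)
      (by rintro rfl; have := beyond c hc hcx; simp at this)
    by_cases hyx : y = xv
    · exact hyx ▸ hcy
    have h1 := dist_eq_add_of_branch_ne hT hy hxv hyx hcy huv'
    have h2 := dist_eq_one_iff_adj.mpr hc.symm
    have h3 := beyond c hc hcx
    omega
  have hdau := beyond au hau.1 hxau.symm
  have hdbu := beyond bu hbu.1.1 hxbu.symm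
  have hdxu : T.dist v xu = p - 1 := by
    have h : T.dist u v = T.dist xu v + 1 := hvu'
    rw [T.dist_comm, T.dist_comm (u := xu)] at h
    omega
  have hav1 := dist_eq_one_iff_adj.mpr hav.1
  have hbv1 := dist_eq_one_iff_adj.mpr hbv.1.1
  have hxv1 := dist_eq_one_iff_adj.mpr hxv
  have hbub : bu ∈ Branch T v xv := beyond_mem bu hbu.1.1 hxbu.symm
  have haub : au ∈ Branch T v xv := beyond_mem au hau.1 hxau.symm
  have leafbu : ∀ z, T.Adj z bu → Branch T z bu = {bu} := by
    intro z hz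
    rw [short_leg_unique_neighbor hT hbu.1.1 hbu.2 hz]
    exact hbu.2
  have line_xv : ∀ w w', w ∈ Branch T v xv → w' ∈ Branch T v xv → w ≠ bu → w' ≠ bu →
      T.dist v w ≤ T.dist v w' → (T.dist w w' : ℤ) = T.dist v w' - T.dist v w := by
    intro w w' hw hw' hwb hwb' hle
    refine dist_eq_abs_of_no_fork hT leafbu _ v xv w w' rfl hxv ?_ hw hw' hwb hwb' hle
    intro z hz y y' hy hy' _ _ hd hd' hyb hyb'
    by_cases hzu : z = u
    · subst hzu
      have : ∀ c, T.Adj z c → T.dist v c = T.dist v z + 1 → c ≠ bu → c = au := by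
        intro c hc hd hcb
        rcases hallu c hc with h | h | h
        · exact h
        · exact absurd h hcb
        · subst h
          omega
      rw [this y hy hd hyb, this y' hy' hd' hyb']
    · have hzv : z ≠ v := by
        rintro rfl
        exact not_mem_branch_self hz
      exact eq_of_degree_le_two hT (hdeg z hzu hzv) hzv hy hy' hd hd'
  have hbu_av : bu ∉ Branch T v av := fun h => hxav (branch_unique hT hxv hav.1 hbub h)
  have line_av : ∀ w w', w ∈ Branch T v av → w' ∈ Branch T v av →
      T.dist v w ≤ T.dist v w' → (T.dist w w' : ℤ) = T.dist v w' - T.dist v w := by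
    intro w w' hw hw' hle
    refine dist_eq_abs_of_no_fork hT leafbu _ v av w w' rfl hav.1 ?_ hw hw'
      (fun h => hbu_av (h ▸ hw)) (fun h => hbu_av (h ▸ hw')) hle
    intro z hz y y' hy hy' _ _ hd hd' _ _
    have hzv : z ≠ v := by
      rintro rfl
      exact not_mem_branch_self hz
    exact eq_of_degree_le_two hT (hav.2 z hz) hzv hy hy' hd hd'
  have cases_w : ∀ w, w ≠ bv → w = v ∨ w ∈ Branch T v av ∨ w ∈ Branch T v xv := by
    intro w hw
    by_cases hwv : w = v
    · exact Or.inl hwv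
    obtain ⟨y, hy, hwy⟩ := exists_mem_branch hT hwv
    rcases hallv y hy with rfl | rfl | rfl
    · exact Or.inr (Or.inl hwy)
    · rw [hbv.2] at hwy
      exact absurd hwy hw
    · exact Or.inr (Or.inr hwy)
  have not_av : ∀ w, w ∈ Branch T v xv → w ∉ Branch T v av :=
    fun w h h' => hxav (branch_unique hT hxv hav.1 h h')
  have ne_bv : ∀ w, w ∈ Branch T v xv → w ≠ bv := by
    rintro w h rfl
    exact hxbv (branch_unique hT hxv hbv.1.1 h (mem_branch_of_adj hbv.1.1))
  have hbuv : bv ≠ bu := fun h => ne_bv bu hbub h.symm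
  have hvbv : v ≠ bv := hbv.1.1.ne
  have hvbu : v ≠ bu := by
    rintro rfl
    exact not_mem_branch_self hbub
  have hubu : u ≠ bu := hbu.1.1.ne
  have hubv : u ≠ bv := ne_bv u huv'
  have hxubu : xu ≠ bu := hxbu
  have hxubv : xu ≠ bv := by
    rintro rfl
    exact huv (short_leg_unique_neighbor hT hbv.1.1 hbv.2 hxu)
  have hxvbu : xv ≠ bu := by
    rintro rfl
    rw [hxv1] at hdbu
    omega
  have hxu_av : xu ∉ Branch T v av := by
    intro h
    have h1 := dist_eq_add_of_branch_ne hT hav.1 hxv hxav.symm h huv'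
    have h2 := dist_eq_one_iff_adj.mpr hxu.symm
    have h3 : T.dist v xu = _ := h
    omega
  classical
  set f : V → ℤ := fun w => if w = bv then 0 else if w = bu then p else
    if w ∈ Branch T v av then -(T.dist v w) else T.dist v w with hf
  have f_av : ∀ w, w ∈ Branch T v av → w ≠ bv → f w = -(T.dist v w) := by
    intro w hw h
    have : w ≠ bu := fun h => hbu_av (h ▸ hw)
    simp [hf, hw, h, this]
  have f_not_av : ∀ w, w ∉ Branch T v av → w ≠ bv → w ≠ bu → f w = T.dist v w := by
    intro w hw h h'
    simp [hf, hw, h, h']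
  have f_v : f v = 0 := by
    rw [f_not_av v not_mem_branch_self hvbv hvbu]
    simp
  have hline : ∀ x y, x ≠ bv → x ≠ bu → y ≠ bv → y ≠ bu →
      (T.dist x y : ℤ) = |f x - f y| := by
    suffices H : ∀ x y, x ≠ bv → x ≠ bu → y ≠ bv → y ≠ bu → T.dist v x ≤ T.dist v y →
        (T.dist x y : ℤ) = |f x - f y| by
      intro x y h1 h2 h3 h4
      rcases le_total (T.dist v x) (T.dist v y) with h | h
      · exact H x y h1 h2 h3 h4 h
      · rw [T.dist_comm, abs_sub_comm]
        exact H y x h3 h4 h1 h2 h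
    intro x y h1 h2 h3 h4 hle
    rcases cases_w x h1 with rfl | hx | hx
    · rw [f_v]
      rcases cases_w y h3 with rfl | hy | hy
      · simp [f_v]
      · simp [f_av y hy h3]
      · simp [f_not_av y (not_av y hy) h3 h4]
    · rw [f_av x hx h1]
      rcases cases_w y h3 with rfl | hy | hy
      · rw [f_v, T.dist_comm]
        simp
      · rw [f_av y hy h3, line_av x y hx hy hle, abs_of_nonneg] <;> omega
      · rw [f_not_av y (not_av y hy) h3 h4,
          dist_eq_add_of_branch_ne hT hav.1 hxv hxav.symm hx hy, abs_of_nonpos] <;> omega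
    · rw [f_not_av x (not_av x hx) h1 h2]
      rcases cases_w y h3 with rfl | hy | hy
      · rw [f_v, T.dist_comm]
        simp
      · rw [f_av y hy h3,
          dist_eq_add_of_branch_ne hT hxv hav.1 hxav hx hy, abs_of_nonneg] <;> omega
      · rw [f_not_av y (not_av y hy) h3 h4, line_xv x y hx hy h2 h4 hle, abs_of_nonpos] <;> omega
  have f_u : f u = p := f_not_av u (not_av u huv') hubv hubu
  have leaf_dist : ∀ s b w, IsShortLeg T s b → w ≠ b → T.dist b w = T.dist s w + 1 := by
    intro s b w hsb hw
    exact (not_mem_branch_iff hT hsb.1.1).mp (by rw [hsb.2]; exact hw)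
  refine ⟨f, p, av, bv, xv, au, bu, xu, ?_⟩
  refine ⟨by omega, f_v, ?_, by simp [hf], ?_, f_u, ?_, by simp [hf, hbuv.symm], ?_,
    hvbv, hxvbu, hubu, hxubv, hline, ?_, ?_, ?_⟩
  · rw [f_av av (mem_branch_of_adj hav.1) habv]
    omega
  · rw [f_not_av xv (not_av xv (mem_branch_of_adj hxv)) hxbv hxvbu]
    omega
  · rw [f_not_av au (not_av au haub) (ne_bv au haub) habu]
    omega
  · rw [f_not_av xu hxu_av hxubv hxubu]
    omega
  · intro x h1 h2
    rw [leaf_dist v bv x hbv h1]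
    push_cast
    rw [hline v x hvbv hvbu h1 h2, f_v]
    simp
  · intro x h1 h2
    rw [leaf_dist u bu x hbu h2]
    push_cast
    rw [hline u x hubv hubu h1 h2, f_u, abs_sub_comm]
  · rw [leaf_dist v bv bu hbv hbuv.symm]
    omega

theorem HasTwoSeparators.symm {V : Type*} {T : SimpleGraph V} {L : Set V} {x y : V}
    (h : HasTwoSeparators T L x y) : HasTwoSeparators T L y x := by
  obtain ⟨s, hs, t, ht, hst, h1, h2⟩ := h
  exact ⟨s, hs, t, ht, hst, h1.symm, h2.symm⟩

namespace IsFrame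

variable {V : Type*} {T : SimpleGraph V} {f : V → ℤ} {p : ℤ} {v av bv xv u au bu xu : V}

theorem symm (h : IsFrame T f p v av bv xv u au bu xu) :
    IsFrame T (fun w => p - f w) p u au bu xu v av bv xv where
  one_le := h.one_le
  f_v := by simp [h.f_u]
  f_av := by simp [h.f_au]
  f_bv := by simp [h.f_bu]
  f_xv := by simp [h.f_xu]
  f_u := by simp [h.f_v]
  f_au := by simp [h.f_av]
  f_bu := by simp [h.f_bv]
  f_xu := by simp [h.f_xv]
  v_ne := h.u_ne
  xv_ne := h.xu_ne
  u_ne := h.v_ne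
  xu_ne := h.xv_ne
  dist_line x y h1 h2 h3 h4 := by
    rw [h.dist_line x y h2 h1 h4 h3, abs_sub_comm]
    congr 1
    ring
  dist_bv x h1 h2 := by rw [h.dist_bu x h2 h1, abs_sub_comm]
  dist_bu x h1 h2 := by
    rw [h.dist_bv x h2 h1, ← abs_neg]
    congr 2
    ring
  dist_bv_bu := by rw [T.dist_comm, h.dist_bv_bu]

theorem v_ne_bu (h : IsFrame T f p v av bv xv u au bu xu) : v ≠ bu := by
  rintro rfl
  have := h.one_le
  have := h.f_v
  have := h.f_bu
  omega

theorem av_ne_bv (h : IsFrame T f p v av bv xv u au bu xu) : av ≠ bv := by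
  rintro rfl
  have := h.f_av
  have := h.f_bv
  omega

theorem av_ne_bu (h : IsFrame T f p v av bv xv u au bu xu) : av ≠ bu := by
  rintro rfl
  have := h.one_le
  have := h.f_av
  have := h.f_bu
  omega

theorem xv_ne_bv (h : IsFrame T f p v av bv xv u au bu xu) : xv ≠ bv := by
  rintro rfl
  have := h.f_xv
  have := h.f_bv
  omega

theorem eq_of_f_eq (h : IsFrame T f p v av bv xv u au bu xu) (hT : T.IsTree) {x y : V}
    (hx : x ≠ bv) (hx' : x ≠ bu) (hy : y ≠ bv) (hy' : y ≠ bu) (hxy : f x = f y) : x = y := by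
  have := h.dist_line x y hx hx' hy hy'
  rw [hxy, sub_self, abs_zero] at this
  exact hT.connected.dist_eq_zero_iff.mp (by exact_mod_cast this)

theorem dist_v (h : IsFrame T f p v av bv xv u au bu xu) {w : V} (hw : w ≠ bv) (hw' : w ≠ bu) :
    (T.dist v w : ℤ) = |f w| := by
  rw [h.dist_line v w h.v_ne h.v_ne_bu hw hw', h.f_v, zero_sub, abs_neg]

theorem dist_v_bv (h : IsFrame T f p v av bv xv u au bu xu) : (T.dist v bv : ℤ) = 1 := by
  rw [T.dist_comm, h.dist_bv v h.v_ne h.v_ne_bu, h.f_v]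
  rfl

theorem dist_v_bu (h : IsFrame T f p v av bv xv u au bu xu) : (T.dist v bu : ℤ) = p + 1 := by
  rw [T.dist_comm, h.dist_bu v h.v_ne h.v_ne_bu, h.f_v, zero_sub, abs_neg,
    abs_of_nonneg (by linarith [h.one_le])]

theorem mem_branch_av (h : IsFrame T f p v av bv xv u au bu xu) {w : V} :
    w ∈ Branch T v av ↔ f w < 0 := by
  have hp := h.one_le
  rw [mem_branch]
  by_cases h1 : w = bv
  · subst h1
    have h2 := h.dist_v_bv
    have h3 := h.dist_bv av h.av_ne_bv h.av_ne_bu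
    rw [T.dist_comm, h.f_av] at h3
    simp only [h.f_bv, abs_neg, abs_one] at h3 ⊢
    omega
  by_cases h1' : w = bu
  · subst h1'
    have h2 := h.dist_v_bu
    have h3 := h.dist_bu av h.av_ne_bv h.av_ne_bu
    rw [T.dist_comm, h.f_av, abs_eq_max_neg] at h3
    have := h.f_bu
    omega
  have h2 := h.dist_v h1 h1'
  have h3 := h.dist_line av w h.av_ne_bv h.av_ne_bu h1 h1'
  rw [h.f_av] at h3
  rw [abs_eq_max_neg] at h2 h3
  omega

theorem mem_branch_xv (h : IsFrame T f p v av bv xv u au bu xu) {w : V} :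
    w ∈ Branch T v xv ↔ 0 < f w := by
  have hp := h.one_le
  rw [mem_branch]
  by_cases h1 : w = bv
  · subst h1
    have h2 := h.dist_v_bv
    have h3 := h.dist_bv xv h.xv_ne_bv h.xv_ne
    rw [T.dist_comm, h.f_xv] at h3
    simp only [h.f_bv, abs_one] at h3 ⊢
    omega
  by_cases h1' : w = bu
  · subst h1'
    have h2 := h.dist_v_bu
    have h3 := h.dist_bu xv h.xv_ne_bv h.xv_ne
    rw [T.dist_comm, h.f_xv, abs_eq_max_neg] at h3
    have := h.f_bu
    omega
  have h2 := h.dist_v h1 h1'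
  have h3 := h.dist_line xv w h.xv_ne_bv h.xv_ne h1 h1'
  rw [h.f_xv] at h3
  rw [abs_eq_max_neg] at h2 h3
  omega

theorem mem_branch_au (h : IsFrame T f p v av bv xv u au bu xu) {w : V} :
    w ∈ Branch T u au ↔ p < f w := by
  rw [h.symm.mem_branch_av, sub_neg]

theorem branch_bv (h : IsFrame T f p v av bv xv u au bu xu) : Branch T v bv = {bv} := by
  have hp := h.one_le
  ext w
  rw [mem_branch, Set.mem_singleton_iff]
  refine ⟨fun hw => ?_, ?_⟩
  · by_contra h1
    by_cases h1' : w = bu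
    · subst h1'
      have h2 := h.dist_v_bu
      have h3 := h.dist_bv_bu
      omega
    have h2 := h.dist_v h1 h1'
    have h3 := h.dist_bv w h1 h1'
    omega
  · rintro rfl
    have h2 := h.dist_v_bv
    simp only [dist_self]
    omega

theorem adj_v_iff (h : IsFrame T f p v av bv xv u au bu xu) (hT : T.IsTree) {y : V} :
    T.Adj v y ↔ y = av ∨ y = bv ∨ y = xv := by
  have hp := h.one_le
  rw [← dist_eq_one_iff_adj]
  constructor
  · intro hy
    by_cases h1 : y = bv
    · exact Or.inr (Or.inl h1)
    by_cases h1' : y = bu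
    · subst h1'
      have h2 := h.dist_v_bu
      omega
    have h2 := h.dist_v h1 h1'
    rw [hy, abs_eq_max_neg] at h2
    rcases le_total (f y) 0 with h0 | h0
    · exact Or.inl (h.eq_of_f_eq hT h1 h1' h.av_ne_bv h.av_ne_bu (by rw [h.f_av]; omega))
    · exact Or.inr (Or.inr (h.eq_of_f_eq hT h1 h1' h.xv_ne_bv h.xv_ne (by rw [h.f_xv]; omega)))
  · rintro (rfl | rfl | rfl)
    · have := h.dist_v h.av_ne_bv h.av_ne_bu
      rw [h.f_av] at this
      norm_num only [abs_neg, abs_one] at this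
      omega
    · exact_mod_cast h.dist_v_bv
    · have := h.dist_v h.xv_ne_bv h.xv_ne
      rw [h.f_xv] at this
      norm_num only [abs_neg, abs_one] at this
      omega

end IsFrame

/-- The requirement on `L` for separating the short leg `b` of a core from the first vertex `a` of
its other standard leg `A`. -/
def LegCondition {V : Type*} (L A : Set V) (a b : V) : Prop :=
  b ∈ L ∨ a ∈ L ∨ (L ∩ A).Nontrivial

/-- The requirement on `L` coming from the modified leg `M` of a core with short leg `b` and other
standard leg `A`. -/
def ModifiedCondition {V : Type*} (L A M : Set V) (b : V) : Prop :=
  (b ∈ L ∧ (L ∩ A).Nonempty) ∨ (L ∩ M).Nontrivial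

namespace IsFrame

variable {V : Type*} {T : SimpleGraph V} {f : V → ℤ} {p : ℤ} {v av bv xv u au bu xu : V}
  {L : Set V}

/-- A vertex fails to separate two line vertices exactly when it sits over their midpoint. -/
theorem separates_line (h : IsFrame T f p v av bv xv u au bu xu) (hT : T.IsTree) {x y τ : V}
    (hx : x ≠ bv) (hx' : x ≠ bu) (hy : y ≠ bv) (hy' : y ≠ bu) (hxy : x ≠ y) :
    Separates T τ x y ↔ 2 * f τ ≠ f x + f y := by
  have hne : f x ≠ f y := fun hf => hxy (h.eq_of_f_eq hT hx hx' hy hy' hf)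
  unfold Separates
  by_cases h1 : τ = bv
  · subst h1
    have h2 := h.dist_bv x hx hx'
    have h3 := h.dist_bv y hy hy'
    rw [abs_eq_max_neg] at h2 h3
    rw [h.f_bv]
    omega
  by_cases h1' : τ = bu
  · subst h1'
    have h2 := h.dist_bu x hx hx'
    have h3 := h.dist_bu y hy hy'
    rw [abs_eq_max_neg] at h2 h3
    rw [h.f_bu]
    omega
  have h2 := h.dist_line τ x h1 h1' hx hx'
  have h3 := h.dist_line τ y h1 h1' hy hy'
  rw [abs_eq_max_neg] at h2 h3
  omega

theorem separates_bv (h : IsFrame T f p v av bv xv u au bu xu) {y τ : V}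
    (hy : y ≠ bv) (hy' : y ≠ bu) (hτ : τ ≠ bv) (hτ' : τ ≠ bu) :
    Separates T τ bv y ↔ |f τ| + 1 ≠ |f τ - f y| := by
  unfold Separates
  have h2 := h.dist_line τ y hτ hτ' hy hy'
  have h3 := h.dist_bv τ hτ hτ'
  rw [T.dist_comm] at h3
  omega

theorem separates_bv_of_bu (h : IsFrame T f p v av bv xv u au bu xu) {y : V}
    (hy : y ≠ bv) (hy' : y ≠ bu) :
    Separates T bu bv y ↔ p + 1 ≠ |f y - p| := by
  unfold Separates
  have h2 := h.dist_bu y hy hy'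
  have h3 := h.dist_bv_bu
  rw [T.dist_comm] at h3
  omega

theorem separates_bv_bu (h : IsFrame T f p v av bv xv u au bu xu) {τ : V}
    (hτ : τ ≠ bv) (hτ' : τ ≠ bu) :
    Separates T τ bv bu ↔ 2 * f τ ≠ p := by
  unfold Separates
  have hp := h.one_le
  have h2 := h.dist_bv τ hτ hτ'
  have h3 := h.dist_bu τ hτ hτ'
  rw [T.dist_comm, abs_eq_max_neg] at h2 h3
  omega

theorem legCondition_of_landmark (h : IsFrame T f p v av bv xv u au bu xu)
    (hL : IsLandmarkSet T L) : LegCondition L (Branch T v av) av bv := by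
  by_contra hcon
  simp only [LegCondition, not_or] at hcon
  obtain ⟨hb, ha, hA⟩ := hcon
  obtain ⟨s, hs, t, ht, hst, h1, h2⟩ := hL bv av h.av_ne_bv.symm hb ha
  have key : ∀ τ ∈ L, Separates T τ bv av → τ ∈ L ∩ Branch T v av := by
    intro τ hτ hsep
    have hp := h.one_le
    have hτb : τ ≠ bv := by
      rintro rfl
      exact hb hτ
    refine ⟨hτ, ?_⟩
    by_cases hτ' : τ = bu
    · subst hτ'
      rw [h.separates_bv_of_bu h.av_ne_bv h.av_ne_bu, h.f_av, abs_eq_max_neg] at hsep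
      omega
    · rw [h.separates_bv h.av_ne_bv h.av_ne_bu hτb hτ', h.f_av, abs_eq_max_neg,
        abs_eq_max_neg] at hsep
      exact h.mem_branch_av.mpr (by omega)
  exact hA ⟨s, key s hs h1, t, key t ht h2, hst⟩

theorem modifiedCondition_of_landmark (h : IsFrame T f p v av bv xv u au bu xu) (hT : T.IsTree)
    (hL : IsLandmarkSet T L) (hleg : LegCondition L (Branch T u au) au bu) :
    ModifiedCondition L (Branch T v av) (Branch T v xv) bv := by
  have hp := h.one_le
  by_contra hcon
  simp only [ModifiedCondition, not_or] at hcon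
  obtain ⟨hbA, hM⟩ := hcon
  have hM' : ∀ s ∈ L, ∀ t ∈ L, 0 < f s → 0 < f t → s = t := by
    intro s hs t ht h1 h2
    by_contra hne
    exact hM ⟨s, ⟨hs, h.mem_branch_xv.mpr h1⟩, t, ⟨ht, h.mem_branch_xv.mpr h2⟩, hne⟩
  obtain ⟨c, hc, hpc, hcx⟩ : ∃ c ∈ L, 0 < f c ∧ c ≠ xv := by
    rcases hleg with hb | ha | ⟨s, ⟨hs, hs'⟩, -⟩
    · exact ⟨bu, hb, by rw [h.f_bu]; omega, h.xv_ne.symm⟩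
    · refine ⟨au, ha, by rw [h.f_au]; omega, ?_⟩
      rintro rfl
      have := h.f_au
      have := h.f_xv
      omega
    · rw [h.mem_branch_au] at hs'
      refine ⟨s, hs, by omega, ?_⟩
      rintro rfl
      have := h.f_xv
      omega
  have hxv : xv ∉ L := fun hx => hcx (hM' c hc xv hx hpc (by rw [h.f_xv]; omega))
  have hbv : bv ∈ L := by
    by_contra hb
    obtain ⟨s, hs, t, ht, hst, h1, h2⟩ := hL bv xv h.xv_ne_bv.symm hb hxv
    have key : ∀ τ ∈ L, Separates T τ bv xv → 0 < f τ := by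
      intro τ hτ hsep
      have hτb : τ ≠ bv := by
        rintro rfl
        exact hb hτ
      by_cases hτ' : τ = bu
      · rw [hτ', h.f_bu]
        omega
      · rw [h.separates_bv h.xv_ne_bv h.xv_ne hτb hτ', h.f_xv, abs_eq_max_neg,
          abs_eq_max_neg] at hsep
        omega
    exact hst (hM' s hs t ht (key s hs h1) (key t ht h2))
  have hA : ∀ w ∈ L, 0 ≤ f w := by
    intro w hw
    by_contra hlt
    exact hbA ⟨hbv, w, hw, h.mem_branch_av.mpr (not_le.mp hlt)⟩
  have hav : av ∉ L := fun ha => by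
    have := hA av ha
    rw [h.f_av] at this
    omega
  have hne : av ≠ xv := by
    rintro rfl
    have := h.f_av
    have := h.f_xv
    omega
  obtain ⟨s, hs, t, ht, hst, h1, h2⟩ := hL av xv hne hav hxv
  rw [h.separates_line hT h.av_ne_bv h.av_ne_bu h.xv_ne_bv h.xv_ne hne, h.f_av, h.f_xv] at h1 h2
  have h3 := hA s hs
  have h4 := hA t ht
  exact hst (hM' s hs t ht (by omega) (by omega))

theorem exists_two_f_ne_zero (h : IsFrame T f p v av bv xv u au bu xu)
    (hu : LegCondition L (Branch T u au) au bu)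
    (hm : ModifiedCondition L (Branch T v av) (Branch T v xv) bv) :
    ∃ s ∈ L, ∃ t ∈ L, s ≠ t ∧ f s ≠ 0 ∧ f t ≠ 0 := by
  have hp := h.one_le
  rcases hm with ⟨-, s, hs, hs'⟩ | ⟨s, ⟨hs, hs'⟩, t, ⟨ht, ht'⟩, hst⟩
  · rw [h.mem_branch_av] at hs'
    obtain ⟨t, ht, ht'⟩ : ∃ t ∈ L, 0 < f t := by
      rcases hu with hb | ha | ⟨t, ⟨ht, ht'⟩, -⟩
      · exact ⟨bu, hb, by rw [h.f_bu]; omega⟩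
      · exact ⟨au, ha, by rw [h.f_au]; omega⟩
      · exact ⟨t, ht, by rw [h.mem_branch_au] at ht'; omega⟩
    refine ⟨s, hs, t, ht, ?_, by omega, by omega⟩
    rintro rfl
    omega
  · rw [h.mem_branch_xv] at hs' ht'
    exact ⟨s, hs, t, ht, hst, by omega, by omega⟩

theorem exists_three (h : IsFrame T f p v av bv xv u au bu xu)
    (hv : LegCondition L (Branch T v av) av bv)
    (hu : LegCondition L (Branch T u au) au bu)
    (hm : ModifiedCondition L (Branch T v av) (Branch T v xv) bv) :
    ∃ r ∈ L, ∃ s ∈ L, ∃ t ∈ L, r ≠ s ∧ r ≠ t ∧ s ≠ t := by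
  have hp := h.one_le
  by_cases hb : bv ∈ L
  · obtain ⟨s, hs, t, ht, hst, hs', ht'⟩ := h.exists_two_f_ne_zero hu hm
    refine ⟨bv, hb, s, hs, t, ht, ?_, ?_, hst⟩ <;>
    · rintro rfl
      have := h.f_bv
      contradiction
  · rcases hm with ⟨hb', -⟩ | ⟨s, ⟨hs, hs'⟩, t, ⟨ht, ht'⟩, hst⟩
    · exact absurd hb' hb
    rw [h.mem_branch_xv] at hs' ht'
    obtain ⟨r, hr, hr'⟩ : ∃ r ∈ L, f r < 0 := by
      rcases hv with hb' | ha | ⟨r, ⟨hr, hr'⟩, -⟩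
      · exact absurd hb' hb
      · exact ⟨av, ha, by rw [h.f_av]; omega⟩
      · exact ⟨r, hr, h.mem_branch_av.mp hr'⟩
    refine ⟨r, hr, s, hs, t, ht, ?_, ?_, hst⟩ <;>
    · rintro rfl
      omega

theorem exists_two_off (h : IsFrame T f p v av bv xv u au bu xu) (hT : T.IsTree)
    (hv : LegCondition L (Branch T v av) av bv)
    (hu : LegCondition L (Branch T u au) au bu)
    (hmv : ModifiedCondition L (Branch T v av) (Branch T v xv) bv)
    (hmu : ModifiedCondition L (Branch T u au) (Branch T u xu) bu) (n : ℤ) :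
    ∃ s ∈ L, ∃ t ∈ L, s ≠ t ∧ 2 * f s ≠ n ∧ 2 * f t ≠ n := by
  by_cases h0 : n = 0
  · obtain ⟨s, hs, t, ht, hst, hs', ht'⟩ := h.exists_two_f_ne_zero hu hmv
    exact ⟨s, hs, t, ht, hst, by omega, by omega⟩
  by_cases h1 : n = 2 * p
  · obtain ⟨s, hs, t, ht, hst, hs', ht'⟩ := h.symm.exists_two_f_ne_zero hv hmu
    exact ⟨s, hs, t, ht, hst, by omega, by omega⟩
  have hinj : ∀ a b, 2 * f a = n → 2 * f b = n → a = b := by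
    have hne : ∀ a, 2 * f a = n → a ≠ bv ∧ a ≠ bu := by
      intro a ha
      constructor
      · rintro rfl
        rw [h.f_bv] at ha
        omega
      · rintro rfl
        rw [h.f_bu] at ha
        omega
    intro a b ha hb
    exact h.eq_of_f_eq hT (hne a ha).1 (hne a ha).2 (hne b hb).1 (hne b hb).2 (by omega)
  obtain ⟨r, hr, s, hs, t, ht, hrs, hrt, hst⟩ := h.exists_three hv hu hmv
  by_cases hrn : 2 * f r = n
  · exact ⟨s, hs, t, ht, hst, fun h' => hrs (hinj _ _ hrn h'), fun h' => hrt (hinj _ _ hrn h')⟩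
  by_cases hsn : 2 * f s = n
  · exact ⟨r, hr, t, ht, hrt, hrn, fun h' => hst (hinj _ _ hsn h')⟩
  · exact ⟨r, hr, s, hs, hrs, hrn, hsn⟩

theorem hasTwoSeparators_bv (h : IsFrame T f p v av bv xv u au bu xu) (hT : T.IsTree)
    (hv : LegCondition L (Branch T v av) av bv)
    (hu : LegCondition L (Branch T u au) au bu)
    (hmv : ModifiedCondition L (Branch T v av) (Branch T v xv) bv)
    (hmu : ModifiedCondition L (Branch T u au) (Branch T u xu) bu)
    (hb : bv ∉ L) {y : V} (hyL : y ∉ L) (hy : y ≠ bv) (hy' : y ≠ bu) :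
    HasTwoSeparators T L bv y := by
  have hp := h.one_le
  have key : ∀ τ ∈ L, (τ ≠ bu → |f τ| + 1 ≠ |f τ - f y|) →
      (τ = bu → p + 1 ≠ |f y - p|) → Separates T τ bv y := by
    intro τ hτ h1 h2
    by_cases hτ' : τ = bu
    · rw [hτ', h.separates_bv_of_bu hy hy']
      exact h2 hτ'
    · rw [h.separates_bv hy hy' (by rintro rfl; exact hb hτ) hτ']
      exact h1 hτ'
  have hfbu := h.f_bu
  simp only [abs_eq_max_neg] at key
  by_cases h1 : f y = -1
  · obtain rfl := h.eq_of_f_eq hT hy hy' h.av_ne_bv h.av_ne_bu (by rw [h.f_av, h1])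
    rcases hv with h' | h' | ⟨s, ⟨hs, hs'⟩, t, ⟨ht, ht'⟩, hst⟩
    · exact absurd h' hb
    · exact absurd h' hyL
    rw [h.mem_branch_av] at hs' ht'
    refine ⟨s, hs, t, ht, hst, key s hs (by omega) ?_, key t ht (by omega) ?_⟩ <;>
    · rintro rfl
      omega
  by_cases h2 : f y = 1
  · rcases hmv with ⟨h', -⟩ | ⟨s, ⟨hs, hs'⟩, t, ⟨ht, ht'⟩, hst⟩
    · exact absurd h' hb
    rw [h.mem_branch_xv] at hs' ht'
    exact ⟨s, hs, t, ht, hst, key s hs (by omega) (by omega), key t ht (by omega) (by omega)⟩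
  obtain ⟨s, hs, t, ht, hst, hs', ht'⟩ :=
    h.exists_two_off hT hv hu hmv hmu (if 0 < f y then f y - 1 else f y + 1)
  refine ⟨s, hs, t, ht, hst, key s hs (fun _ => ?_) ?_, key t ht (fun _ => ?_) ?_⟩
  · split_ifs at hs' <;> omega
  · rintro rfl
    split_ifs at hs' <;> omega
  · split_ifs at ht' <;> omega
  · rintro rfl
    split_ifs at ht' <;> omega

theorem isLandmarkSet_iff (h : IsFrame T f p v av bv xv u au bu xu) (hT : T.IsTree) :
    IsLandmarkSet T L ↔
      (LegCondition L (Branch T v av) av bv ∧ LegCondition L (Branch T u au) au bu) ∧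
      (ModifiedCondition L (Branch T v av) (Branch T v xv) bv ∧
        ModifiedCondition L (Branch T u au) (Branch T u xu) bu) := by
  constructor
  · intro hL
    have hv := h.legCondition_of_landmark hL
    have hu := h.symm.legCondition_of_landmark hL
    exact ⟨⟨hv, hu⟩, h.modifiedCondition_of_landmark hT hL hu,
      h.symm.modifiedCondition_of_landmark hT hL hv⟩
  rintro ⟨⟨hv, hu⟩, hmv, hmu⟩
  have hbb : bv ∉ L → bu ∉ L → HasTwoSeparators T L bv bu := by
    intro h1 h2
    obtain ⟨s, hs, t, ht, hst, hs', ht'⟩ := h.exists_two_off hT hv hu hmv hmu p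
    have key : ∀ τ ∈ L, 2 * f τ ≠ p → Separates T τ bv bu := fun τ hτ h3 =>
      (h.separates_bv_bu (by rintro rfl; exact h1 hτ) (by rintro rfl; exact h2 hτ)).mpr h3
    exact ⟨s, hs, t, ht, hst, key s hs hs', key t ht ht'⟩
  intro x y hxy hx hy
  by_cases hxv : x = bv
  · subst hxv
    by_cases hyu : y = bu
    · subst hyu
      exact hbb hx hy
    · exact h.hasTwoSeparators_bv hT hv hu hmv hmu hx hy hxy.symm hyu
  by_cases hxu : x = bu
  · subst hxu
    by_cases hyv : y = bv
    · subst hyv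
      exact (hbb hy hx).symm
    · exact h.symm.hasTwoSeparators_bv hT hu hv hmu hmv hx hy hxy.symm hyv
  by_cases hyv : y = bv
  · subst hyv
    exact (h.hasTwoSeparators_bv hT hv hu hmv hmu hy hx hxv hxu).symm
  by_cases hyu : y = bu
  · subst hyu
    exact (h.symm.hasTwoSeparators_bv hT hu hv hmu hmv hy hx hxu hxv).symm
  obtain ⟨s, hs, t, ht, hst, hs', ht'⟩ :=
    h.exists_two_off hT hv hu hmv hmu (f x + f y)
  exact ⟨s, hs, t, ht, hst, (h.separates_line hT hxv hxu hyv hyu hxy).mpr hs',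
    (h.separates_line hT hxv hxu hyv hyu hxy).mpr ht'⟩

theorem eq_au_or_eq_bu (h : IsFrame T f p v av bv xv u au bu xu) (hT : T.IsTree) {c : V}
    (hc : c ∈ Branch T v xv) (hd : T.dist v c = T.dist v u + 1) : c = au ∨ c = bu := by
  have hp := h.one_le
  have h1 := h.f_u
  have h2 := h.f_au
  have d1 := h.dist_v h.symm.v_ne_bu h.u_ne
  rw [h.mem_branch_xv] at hc
  by_cases hcb : c = bu
  · exact Or.inr hcb
  have hcv : c ≠ bv := by
    rintro rfl
    linarith [h.f_bv]
  have d2 := h.dist_v hcv hcb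
  rw [abs_eq_max_neg] at d1 d2
  exact Or.inl (h.eq_of_f_eq hT hcv hcb h.symm.av_ne_bu h.symm.av_ne_bv (by omega))

theorem branch_au_subset (h : IsFrame T f p v av bv xv u au bu xu) :
    Branch T u au ⊆ Branch T v xv := by
  intro w hw
  rw [h.mem_branch_au] at hw
  rw [h.mem_branch_xv]
  linarith [h.one_le]

theorem mem_branch_au_iff_dist (h : IsFrame T f p v av bv xv u au bu xu) (hT : T.IsTree)
    {w : V} (hw : w ∈ Branch T v xv) (hwa : w ≠ au) (hwb : w ≠ bu) :
    w ∈ Branch T u au ↔ T.dist v u + 2 ≤ T.dist v w := by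
  have hp := h.one_le
  have h1 := h.f_u
  have hne : T.dist v w ≠ T.dist v u + 1 := fun hd =>
    (h.eq_au_or_eq_bu hT hw hd).elim hwa hwb
  have d1 := h.dist_v h.symm.v_ne_bu h.u_ne
  rw [h.mem_branch_xv] at hw
  have hwv : w ≠ bv := by
    rintro rfl
    linarith [h.f_bv]
  have d2 := h.dist_v hwv hwb
  rw [abs_eq_max_neg] at d1 d2
  rw [h.mem_branch_au]
  omega

end IsFrame

namespace IsFrame

variable {V : Type*} [Fintype V] {T : SimpleGraph V} [DecidableRel T.Adj]
  {f : V → ℤ} {p : ℤ} {v av bv xv u au bu xu : V} {L : Set V}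

theorem isStandardLeg_av (h : IsFrame T f p v av bv xv u au bu xu) (hT : T.IsTree)
    (huniq : ∀ w : V, IsCore T w → w = u ∨ w = v) : IsStandardLeg T v av := by
  refine ⟨(h.adj_v_iff hT).mpr (Or.inl rfl), fun w hw => ?_⟩
  by_contra hd
  have hp := h.one_le
  have hu := h.f_u
  have hv := h.f_v
  rw [h.mem_branch_av] at hw
  rcases huniq w (by unfold IsCore; omega) with rfl | rfl <;> omega

theorem isShortLeg_bv (h : IsFrame T f p v av bv xv u au bu xu) (hT : T.IsTree)
    (huniq : ∀ w : V, IsCore T w → w = u ∨ w = v) : IsShortLeg T v bv := by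
  refine ⟨⟨(h.adj_v_iff hT).mpr (Or.inr (Or.inl rfl)), fun w hw => ?_⟩, h.branch_bv⟩
  rw [h.branch_bv, Set.mem_singleton_iff] at hw
  subst hw
  by_contra hd
  have hp := h.one_le
  have hu := h.f_u
  have hw := h.f_bv
  rcases huniq w (by unfold IsCore; omega) with h1 | h1
  · rw [h1] at hw
    omega
  · exact h.v_ne h1.symm

theorem isStandardLeg_iff (h : IsFrame T f p v av bv xv u au bu xu) (hT : T.IsTree)
    (hu : IsSmallCore T u) (huniq : ∀ w : V, IsCore T w → w = u ∨ w = v) {x : V} :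
    IsStandardLeg T v x ↔ x = av ∨ x = bv := by
  constructor
  · intro hx
    rcases (h.adj_v_iff hT).mp hx.1 with rfl | rfl | rfl
    · exact Or.inl rfl
    · exact Or.inr rfl
    · have hd := hu.1
      have := hx.2 u (h.mem_branch_xv.mpr (by linarith [h.f_u, h.one_le]))
      omega
  · rintro (rfl | rfl)
    exacts [h.isStandardLeg_av hT huniq, (h.isShortLeg_bv hT huniq).1]

theorem isModifiedLeg_iff (h : IsFrame T f p v av bv xv u au bu xu) (hT : T.IsTree)
    (hu : IsSmallCore T u) (huniq : ∀ w : V, IsCore T w → w = u ∨ w = v) {x : V} :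
    IsModifiedLeg T v x ↔ x = xv := by
  constructor
  · rintro ⟨hx, w, hw, hwc, -⟩
    have hd := hwc.1
    rcases (h.adj_v_iff hT).mp hx with rfl | rfl | rfl
    · have := (h.isStandardLeg_av hT huniq).2 w hw
      omega
    · have := (h.isShortLeg_bv hT huniq).1.2 w hw
      omega
    · rfl
  · rintro rfl
    refine ⟨(h.adj_v_iff hT).mpr (Or.inr (Or.inr rfl)), u,
      h.mem_branch_xv.mpr (by linarith [h.f_u, h.one_le]), hu, fun w hw hwc => ?_⟩
    rcases huniq w hwc with rfl | rfl
    · rfl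
    · exact absurd hw not_mem_branch_self

theorem mLegPair (h : IsFrame T f p v av bv xv u au bu xu) (hT : T.IsTree)
    (hu : IsSmallCore T u) (huniq : ∀ w : V, IsCore T w → w = u ∨ w = v) :
    MLegPair T v xv u au bu := by
  have hp := h.one_le
  have h1 := h.f_u
  have h2 := h.f_au
  have h3 := h.f_bu
  have d1 := h.dist_v h.symm.v_ne_bu h.u_ne
  have d2 := h.dist_v h.symm.av_ne_bu h.symm.av_ne_bv
  have d3 := h.dist_v_bu
  rw [abs_eq_max_neg] at d1 d2
  refine ⟨h.mem_branch_xv.mpr (by omega), hu, h.symm.av_ne_bv, h.mem_branch_xv.mpr (by omega),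
    h.mem_branch_xv.mpr (by omega), by omega, by omega,
    h.symm.isShortLeg_bv hT (fun w hw => (huniq w hw).symm)⟩

theorem mLegPair_cases (h : IsFrame T f p v av bv xv u au bu xu) (hT : T.IsTree)
    (huniq : ∀ w : V, IsCore T w → w = u ∨ w = v) {w a b : V}
    (hw : MLegPair T v xv w a b) :
    w = u ∧ ((a = au ∧ b = bu) ∨ (a = bu ∧ b = au)) := by
  obtain ⟨hwb, hwc, hab, ha, hb, hda, hdb, -⟩ := hw
  have hwu : w = u := by
    rcases huniq w (by unfold IsCore; exact hwc.1.ge) with rfl | rfl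
    · rfl
    · exact absurd hwb not_mem_branch_self
  subst hwu
  refine ⟨rfl, ?_⟩
  rcases h.eq_au_or_eq_bu hT ha hda with rfl | rfl <;>
    rcases h.eq_au_or_eq_bu hT hb hdb with rfl | rfl <;> simp_all

theorem conditions_of_isLocalSet (h : IsFrame T f p v av bv xv u au bu xu) (hT : T.IsTree)
    (hu : IsSmallCore T u) (huniq : ∀ w : V, IsCore T w → w = u ∨ w = v) {S : Set V}
    (hSL : S ⊆ L) (hS : IsLocalSet T v S) :
    LegCondition L (Branch T v av) av bv ∧ LegCondition L (Branch T u au) au bu ∧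
      ModifiedCondition L (Branch T v av) (Branch T v xv) bv := by
  obtain ⟨-, hS1, -, hS2, hS3, -, hS5⟩ := hS
  have hav := h.isStandardLeg_av hT huniq
  have hbv := h.isShortLeg_bv hT huniq
  have hmod := (h.isModifiedLeg_iff hT hu huniq).mpr rfl
  have hmono : ∀ B : Set V, (∃ w₁ ∈ S ∩ B, ∃ w₂ ∈ S ∩ B, w₁ ≠ w₂) → (L ∩ B).Nontrivial := by
    rintro B ⟨s, hs, t, ht, hst⟩
    exact ⟨s, ⟨hSL hs.1, hs.2⟩, t, ⟨hSL ht.1, ht.2⟩, hst⟩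
  have hbv0 : bv ∉ S → SolS0 T v bv S := by
    intro hb
    rw [SolS0, h.branch_bv, Set.inter_singleton_eq_empty]
    exact hb
  refine ⟨?_, ?_, ?_⟩
  · by_cases hb : bv ∈ S
    · exact Or.inl (hSL hb)
    by_cases hlong : Branch T v av = {av}
    · right; left
      by_contra ha
      refine hS1 av bv hav hbv.1 h.av_ne_bv ?_ (hbv0 hb)
      rw [SolS0, hlong, Set.inter_singleton_eq_empty]
      exact fun h' => ha (hSL h')
    · rcases hS5 ⟨bv, hbv, hbv0 hb⟩ av ⟨hav, hlong⟩ with h2 | h3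
      · exact Or.inr (Or.inr (hmono _ h2))
      · have : av ∈ S ∩ Branch T v av := by
          rw [h3]
          rfl
        exact Or.inr (Or.inl (hSL this.1))
  · have hor : au ∈ S ∨ bu ∈ S → LegCondition L (Branch T u au) au bu := by
      rintro (h' | h')
      · exact Or.inr (Or.inl (hSL h'))
      · exact Or.inl (hSL h')
    rcases hS2 xv hmod with ⟨w, a, b, hw, hab⟩ |
      ⟨w, a, b, hw, ha, hb, ⟨s, hs, t, ht, hst, hds, hdt⟩, -⟩ |
      ⟨w, a, b, hw, -, hab⟩
    · have hab' : a ∈ S ∨ b ∈ S := by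
        rcases hab with hab | hab
        · exact Or.inl (hab.symm ▸ Set.mem_singleton a : a ∈ S ∩ _).1
        · exact Or.inr (hab.symm ▸ Set.mem_singleton b : b ∈ S ∩ _).1
      obtain ⟨-, ⟨rfl, rfl⟩ | ⟨rfl, rfl⟩⟩ := h.mLegPair_cases hT huniq hw
      exacts [hor hab', hor hab'.symm]
    · obtain ⟨rfl, hc⟩ := h.mLegPair_cases hT huniq hw
      have hn : au ∉ S ∧ bu ∉ S := by
        obtain ⟨rfl, rfl⟩ | ⟨rfl, rfl⟩ := hc
        exacts [⟨ha, hb⟩, ⟨hb, ha⟩]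
      have key : ∀ r ∈ S ∩ Branch T v xv, T.dist v w + 2 ≤ T.dist v r →
          r ∈ L ∩ Branch T w au := fun r hr hd =>
        ⟨hSL hr.1, (h.mem_branch_au_iff_dist hT hr.2 (fun h' => hn.1 (h' ▸ hr.1))
          (fun h' => hn.2 (h' ▸ hr.1))).mpr hd⟩
      exact Or.inr (Or.inr ⟨s, key s hs hds, t, key t ht hdt, hst⟩)
    · obtain ⟨-, ⟨rfl, rfl⟩ | ⟨rfl, rfl⟩⟩ := h.mLegPair_cases hT huniq hw
      exacts [hor hab, hor hab.symm]
  · by_cases h0 : SolS0 T v av S ∨ bv ∉ S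
    · right
      have hex : ∃ x, IsStandardLeg T v x ∧ SolS0 T v x S := by
        rcases h0 with h0 | h0
        exacts [⟨av, hav, h0⟩, ⟨bv, hbv.1, hbv0 h0⟩]
      rcases hS2 xv hmod with h1 | ⟨w, a, b, -, -, -, ⟨s, hs, t, ht, hst, -⟩, -⟩ |
        ⟨w, a, b, -, hst, -⟩
      · exact absurd h1 (hS3 hex xv hmod)
      · exact hmono _ ⟨s, hs, t, ht, hst⟩
      · exact hmono _ hst
    · left
      simp only [not_or, not_not] at h0
      obtain ⟨w, hw⟩ := Set.nonempty_iff_ne_empty.mpr h0.1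
      exact ⟨hSL h0.2, w, hSL hw.1, hw.2⟩

theorem isLocalSet_diff (h : IsFrame T f p v av bv xv u au bu xu) (hT : T.IsTree)
    (hu : IsSmallCore T u) (huniq : ∀ w : V, IsCore T w → w = u ∨ w = v)
    (hlv : LegCondition L (Branch T v av) av bv) (hlu : LegCondition L (Branch T u au) au bu)
    (hm : ModifiedCondition L (Branch T v av) (Branch T v xv) bv) :
    IsLocalSet T v (L \ {v}) := by
  have hav := h.isStandardLeg_av hT huniq
  have hbv := h.isShortLeg_bv hT huniq
  have hmod := (h.isModifiedLeg_iff hT hu huniq).mpr rfl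
  have hstd := fun x => h.isStandardLeg_iff hT hu huniq (x := x)
  have hinter : ∀ x, (L \ {v}) ∩ Branch T v x = L ∩ Branch T v x := by
    intro x
    ext w
    simp only [Set.mem_inter_iff, Set.mem_sdiff, Set.mem_singleton_iff]
    refine ⟨fun hw => ⟨hw.1.1, hw.2⟩, fun hw => ⟨⟨hw.1, ?_⟩, hw.2⟩⟩
    rintro rfl
    exact not_mem_branch_self hw.2
  have hbv0 : SolS0 T v bv (L \ {v}) → bv ∉ L := by
    intro h0 hb
    rw [SolS0, hinter, h.branch_bv] at h0
    exact Set.notMem_empty bv (h0 ▸ ⟨hb, rfl⟩)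
  have hav0 : SolS0 T v av (L \ {v}) → ¬ (L ∩ Branch T v av).Nonempty := by
    intro h0
    rw [SolS0, hinter] at h0
    simp [h0]
  have hpair := h.mLegPair hT hu huniq
  refine ⟨?_, ?_, ?_, ?_, ?_, ?_, ?_⟩
  · rintro w ⟨-, hwv⟩
    obtain ⟨x, hx, hw⟩ := exists_mem_branch hT (v := v) (w := w) hwv
    refine ⟨x, ?_, hw⟩
    rcases (h.adj_v_iff hT).mp hx with rfl | rfl | rfl
    exacts [Or.inl hav, Or.inl hbv.1, Or.inr hmod]
  · have key : SolS0 T v av (L \ {v}) → SolS0 T v bv (L \ {v}) → False := by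
      intro ha hb
      rcases hlv with h1 | h1 | h1
      · exact hbv0 hb h1
      · exact hav0 ha ⟨av, h1, mem_branch_of_adj hav.1⟩
      · exact hav0 ha h1.nonempty
    intro x y hx hy hxy h0 h0'
    rcases (hstd x).mp hx with rfl | rfl <;> rcases (hstd y).mp hy with rfl | rfl
    exacts [hxy rfl, key h0 h0', key h0' h0, hxy rfl]
  · intro x hx
    rcases Set.eq_empty_or_nonempty ((L \ {v}) ∩ Branch T v x) with h0 | ⟨w, hw⟩
    · exact Or.inl h0
    by_cases hnt : ((L \ {v}) ∩ Branch T v x).Nontrivial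
    · exact Or.inr (Or.inr (Or.inl hnt))
    have hsing := (Set.not_nontrivial_iff.mp hnt).eq_singleton_of_mem hw
    by_cases hwx : w = x
    · subst hwx
      exact Or.inr (Or.inr (Or.inr hsing))
    · refine Or.inr (Or.inl ⟨w, hsing, ?_⟩)
      have h1 := mem_branch.mp hw.2
      have h2 := hT.connected.pos_dist_of_ne (Ne.symm hwx)
      omega
  · intro x hx
    obtain rfl := (h.isModifiedLeg_iff hT hu huniq).mp hx
    have hor : au ∈ L ∨ bu ∈ L → SolM1 T v x (L \ {v}) ∨ SolM3 T v x (L \ {v}) := by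
      intro hab
      by_cases hnt : (L ∩ Branch T v x).Nontrivial
      · refine Or.inr ⟨u, au, bu, hpair, by rw [hinter]; exact hnt, ?_⟩
        have : ∀ c ∈ Branch T v x, c ∈ L → c ∈ L \ {v} := fun c hc hcL =>
          ((hinter x).ge ⟨hcL, hc⟩).1
        exact hab.imp (this au hpair.2.2.2.1) (this bu hpair.2.2.2.2.1)
      · refine Or.inl ⟨u, au, bu, hpair, ?_⟩
        rw [hinter]
        rw [Set.not_nontrivial_iff] at hnt
        exact hab.imp (fun ha => hnt.eq_singleton_of_mem ⟨ha, hpair.2.2.2.1⟩)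
          (fun hb => hnt.eq_singleton_of_mem ⟨hb, hpair.2.2.2.2.1⟩)
    by_cases hab : au ∈ L ∨ bu ∈ L
    · exact (hor hab).imp id Or.inr
    · have hab' := not_or.mp hab
      rcases hlu with h1 | h1 | ⟨s, hs, t, ht, hst⟩
      · exact absurd (Or.inr h1) hab
      · exact absurd (Or.inl h1) hab
      refine Or.inr (Or.inl ⟨u, au, bu, hpair, fun h' => hab'.1 h'.1,
        fun h' => hab'.2 h'.1, ?_, ?_⟩)
      · rw [hinter]
        have key : ∀ r ∈ L ∩ Branch T u au,
            r ∈ L ∩ Branch T v x ∧ T.dist v u + 2 ≤ T.dist v r := fun r hr =>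
          ⟨⟨hr.1, h.branch_au_subset hr.2⟩,
            (h.mem_branch_au_iff_dist hT (h.branch_au_subset hr.2)
              (fun h' => hab'.1 (h' ▸ hr.1)) (fun h' => hab'.2 (h' ▸ hr.1))).mp hr.2⟩
        exact ⟨s, (key s hs).1, t, (key t ht).1, hst, (key s hs).2, (key t ht).2⟩
      · rintro w hw hd
        rw [hinter] at hw
        rcases h.eq_au_or_eq_bu hT hw.2 hd with rfl | rfl
        exacts [hab'.1 hw.1, hab'.2 hw.1]
  · rintro ⟨x, hx, h0⟩ y hy ⟨w, a, b, -, hab⟩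
    obtain rfl := (h.isModifiedLeg_iff hT hu huniq).mp hy
    have hnt : (L ∩ Branch T v y).Nontrivial := by
      rcases hm with ⟨hb, ha⟩ | hnt
      · rcases (hstd x).mp hx with rfl | rfl
        exacts [absurd ha (hav0 h0), absurd hb (hbv0 h0)]
      · exact hnt
    rw [hinter] at hab
    rcases hab with hab | hab <;>
    · rw [hab] at hnt
      exact Set.not_nontrivial_singleton hnt
  · have key : ∀ x, IsLongLeg T v x → x = av := by
      intro x hx
      rcases (hstd x).mp hx.1 with rfl | rfl
      exacts [rfl, absurd h.branch_bv hx.2]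
    intro x hx _ y hy hyx
    exact absurd ((key y hy).trans (key x hx).symm) hyx
  · rintro ⟨x, hx, h0⟩ y hy
    have hya : y = av := by
      rcases (hstd y).mp hy.1 with rfl | rfl
      exacts [rfl, absurd h.branch_bv hy.2]
    subst hya
    have hxb : x = bv := by
      rcases (hstd x).mp hx.1 with rfl | rfl
      exacts [absurd hx.2 hy.2, rfl]
    subst hxb
    unfold SolS2 SolS3
    rw [hinter]
    rcases hlv with h1 | h1 | h1
    · exact absurd h1 (hbv0 h0)
    · by_cases hnt : (L ∩ Branch T v y).Nontrivial
      · exact Or.inl hnt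
      · exact Or.inr ((Set.not_nontrivial_iff.mp hnt).eq_singleton_of_mem
          ⟨h1, mem_branch_of_adj hav.1⟩)
    · exact Or.inl h1

theorem exists_isLocalSet_iff (h : IsFrame T f p v av bv xv u au bu xu) (hT : T.IsTree)
    (hu : IsSmallCore T u) (huniq : ∀ w : V, IsCore T w → w = u ∨ w = v) :
    (∃ S ⊆ L, IsLocalSet T v S) ↔
      LegCondition L (Branch T v av) av bv ∧ LegCondition L (Branch T u au) au bu ∧
        ModifiedCondition L (Branch T v av) (Branch T v xv) bv :=
  ⟨fun ⟨_, hSL, hS⟩ => h.conditions_of_isLocalSet hT hu huniq hSL hS,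
    fun ⟨h1, h2, h3⟩ => ⟨_, Set.sdiff_subset, h.isLocalSet_diff hT hu huniq h1 h2 h3⟩⟩

end IsFrame

/-- a tree with no regular cores and exactly two (small) cores `u` and
`v`; `L` is a landmark set iff it contains a local set for the g-legs of `v` and a
local set for the g-legs of `u`. -/
theorem two_small_cores_landmark_iff
    (T : SimpleGraph V) [DecidableRel T.Adj] (hT : T.IsTree)
    (u v : V) (huv : u ≠ v)
    (hu : IsSmallCore T u) (hv : IsSmallCore T v)
    (huniq : ∀ w : V, IsCore T w → w = u ∨ w = v)
    (L : Set V) :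
    IsLandmarkSet T L ↔
      ((∃ S : Set V, S ⊆ L ∧ IsLocalSet T v S) ∧
       (∃ S : Set V, S ⊆ L ∧ IsLocalSet T u S)) := by
  obtain ⟨f, p, av, bv, xv, au, bu, xu, h⟩ := exists_isFrame hT huv hu hv huniq
  have h1 := h.exists_isLocalSet_iff (L := L) hT hu huniq
  have h2 := h.symm.exists_isLocalSet_iff (L := L) hT hv fun w hw => (huniq w hw).symm
  rw [h.isLandmarkSet_iff hT, h1, h2]
  tauto
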